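/- arXiv:2310.15064 — 2 statements merged into one kernel-verified Lean document; each statement's English description precedes it below -/
import Mathlib

section
/- Let k be an odd integer with k ≡ 3 (mod 8) and k ≥ 11. Then at least one of the clipped Thue–Morse morphisms f_{k−5, k} and f_{k−4, k} is cubefree. -/
/-- The Thue–Morse word: `tm n` is the parity of the number of 1s in the
binary representation of `n` (`true` = letter 1, `false` = letter 0). -/
def tm (n : ℕ) : Bool := ((Nat.digits 2 n).count 1) % 2 == 1

/-- The factor `t[ℓ..ℓ+k-1]` of the Thue–Morse word. -/
def tmFactor (ℓ k : ℕ) : List Bool := (List.range k).map (fun i => tm (ℓ + i))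

/-- Complement of a binary word (exchange 0 and 1 in every position). -/
def wcompl (w : List Bool) : List Bool := w.map (fun b => !b)

/-- Apply the binary morphism `0 ↦ h0, 1 ↦ h1` to the word `w`. -/
def applyMorph (h0 h1 : List Bool) (w : List Bool) : List Bool :=
  (w.map (fun b => bif b then h1 else h0)).flatten

/-- The Thue–Morse morphism μ : 0 ↦ 01, 1 ↦ 10. -/
def mu : List Bool → List Bool := applyMorph [false, true] [true, false]

/-- `p` is a period of the finite word `w`: `1 ≤ p ≤ |w|` and `w[i] = w[i+p]`
for all `i` with `i + p < |w|`. -/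
def HasPeriodW (w : List Bool) (p : ℕ) : Prop :=
  1 ≤ p ∧ p ≤ w.length ∧ ∀ i, i + p < w.length → w.getD i false = w.getD (i + p) false

/-- The smallest period of `w`. -/
noncomputable def per (w : List Bool) : ℕ := sInf {p | HasPeriodW w p}

/-- The exponent of `w`: `|w| / per(w)`. -/
noncomputable def wexp (w : List Bool) : ℝ := (w.length : ℝ) / (per w : ℝ)

/-- The critical exponent of `w`: supremum of exponents of nonempty factors of `w`. -/
noncomputable def ce (w : List Bool) : ℝ :=
  sSup {r : ℝ | ∃ x : List Bool, x ≠ [] ∧ x <:+: w ∧ r = wexp x}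

/-- A `k`-prefix: the length-`k` prefix of the Thue–Morse word, or its complement. -/
def kPrefix (k : ℕ) (s : List Bool) : Prop :=
  s = tmFactor 0 k ∨ s = wcompl (tmFactor 0 k)

/-- `v` is a finite factor of the Thue–Morse word. -/
def IsTMFactor (v : List Bool) : Prop := ∃ ℓ, v = tmFactor ℓ v.length

/-- The complementary morphism `0 ↦ h0, 1 ↦ complement of h0` is cubefree:
it maps every word of critical exponent `< 3` to a word of critical exponent `< 3`. -/
def CubefreeC (h0 : List Bool) : Prop :=
  ∀ w : List Bool, ce w < 3 → ce (applyMorph h0 (wcompl h0) w) < 3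

/-- The word `x` occurs at position `i` of the word `w`. -/
def OccursAt (x w : List Bool) (i : ℕ) : Prop :=
  i + x.length ≤ w.length ∧ (w.drop i).take x.length = x

theorem tm_two_mul (n : ℕ) : tm (2 * n) = tm n := by
  rcases Nat.eq_zero_or_pos n with rfl | hn
  · rfl
  · simp [tm, Nat.digits_def' (b := 2) (by norm_num) (show 0 < 2 * n by omega)]

theorem tm_two_mul_add_one (n : ℕ) : tm (2 * n + 1) = !tm n := by
  unfold tm
  rw [Nat.digits_def' (b := 2) (by norm_num) (show 0 < 2 * n + 1 by omega),
    show (2 * n + 1) % 2 = 1 by omega, show (2 * n + 1) / 2 = n by omega, List.count_cons_self]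
  rcases Nat.mod_two_eq_zero_or_one (List.count 1 (Nat.digits 2 n)) with h | h <;>
    simp [Nat.add_mod, h]

/-- Equal adjacent letters of the Thue–Morse word start at odd positions. -/
theorem odd_of_tm_eq_succ {i : ℕ} (h : tm i = tm (i + 1)) : i % 2 = 1 := by
  by_contra hi
  obtain ⟨j, rfl⟩ : ∃ j, i = 2 * j := ⟨i / 2, by omega⟩
  rw [tm_two_mul, tm_two_mul_add_one] at h
  simp at h

theorem exists_tm_eq_succ (n : ℕ) : ∃ i, n ≤ i ∧ i ≤ n + 3 ∧ tm i = tm (i + 1) := by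
  by_contra! hcon
  obtain ⟨j, hj⟩ : ∃ j, n = 2 * j + 1 ∨ n + 1 = 2 * j + 1 := ⟨n / 2, by omega⟩
  have key : ∀ a, n ≤ 2 * a + 1 → 2 * a + 1 ≤ n + 3 → tm a = tm (a + 1) := fun a h1 h2 => by
    have := hcon _ h1 h2
    rw [tm_two_mul_add_one, show 2 * a + 1 + 1 = 2 * (a + 1) by ring, tm_two_mul] at this
    revert this
    cases tm a <;> cases tm (a + 1) <;> simp
  have h1 := odd_of_tm_eq_succ (key j (by omega) (by omega))
  have h2 := odd_of_tm_eq_succ (key (j + 1) (by omega) (by omega))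
  omega

/-- The Thue–Morse word is overlap-free. -/
theorem tm_overlap_free (p s : ℕ) (hp : 1 ≤ p) :
    ¬ ∀ i, s ≤ i → i ≤ s + p → tm i = tm (i + p) := by
  induction p using Nat.strong_induction_on generalizing s with
  | _ p ih =>
    intro h
    rcases Nat.even_or_odd' p with ⟨q, rfl | rfl⟩
    · rcases Nat.even_or_odd' s with ⟨a, rfl | rfl⟩
      · refine ih q (by omega) a (by omega) fun i h1 h2 => ?_
        have := h (2 * i) (by omega) (by omega)
        rwa [← mul_add, tm_two_mul, tm_two_mul] at this
      · refine ih q (by omega) a (by omega) fun i h1 h2 => ?_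
        have := h (2 * i + 1) (by omega) (by omega)
        rw [show 2 * i + 1 + 2 * q = 2 * (i + q) + 1 by ring, tm_two_mul_add_one,
          tm_two_mul_add_one] at this
        simpa using this
    · have key : ∀ i, s ≤ i → i + 1 ≤ s + (2 * q + 1) → tm i ≠ tm (i + 1) := fun i h1 h2 he => by
        have h3 := h i h1 (by omega)
        have h4 := h (i + 1) (by omega) h2
        have h5 := odd_of_tm_eq_succ he
        have h6 : tm (i + (2 * q + 1)) = tm (i + (2 * q + 1) + 1) := by
          rw [← h3, he, h4]; congr 1; omega
        have := odd_of_tm_eq_succ h6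
        omega
      obtain ⟨i, h1, h2, h3⟩ := exists_tm_eq_succ s
      rcases lt_or_ge i (s + (2 * q + 1)) with hi | hi
      · exact key i h1 (by omega) h3
      · have hq : q = 0 ∨ q = 1 := by omega
        rcases hq with rfl | rfl
        · have h4 := h s le_rfl (by omega)
          exact key s le_rfl (by omega) h4
        · obtain rfl : i = s + 3 := by omega
          have h4 := h s le_rfl (by omega)
          have h5 := h (s + 1) (by omega) (by omega)
          refine key s le_rfl (by omega) ?_
          rw [h4, h5]
          convert h3 using 2

theorem tm_two_pow_mul_add (j a y : ℕ) (hy : y < 2 ^ j) : tm (2 ^ j * a + y) = (tm a ^^ tm y) := by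
  induction j generalizing y with
  | zero =>
    obtain rfl : y = 0 := by simpa using hy
    simp [show tm 0 = false from rfl]
  | succ j ih =>
    rw [pow_succ] at hy
    rcases Nat.even_or_odd' y with ⟨b, rfl | rfl⟩
    · rw [show 2 ^ (j + 1) * a + 2 * b = 2 * (2 ^ j * a + b) by ring, tm_two_mul, tm_two_mul,
        ih b (by omega)]
    · rw [show 2 ^ (j + 1) * a + (2 * b + 1) = 2 * (2 ^ j * a + b) + 1 by ring,
        tm_two_mul_add_one, tm_two_mul_add_one, ih b (by omega)]
      simp

/-- `f` has a cube of period `p` starting at position `s`. -/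
def CubeAt (f : ℕ → Bool) (s p : ℕ) : Prop :=
  ∀ i, s ≤ i → i < s + 2 * p → f i = f (i + p)

theorem ce_lt_three_iff (w : List Bool) : ce w < 3 ↔
    ∀ s p, 1 ≤ p → s + 3 * p ≤ w.length → ¬ CubeAt (fun i => w.getD i false) s p := by
  set S := {r : ℝ | ∃ x : List Bool, x ≠ [] ∧ x <:+: w ∧ r = wexp x} with hS
  have hfin : S.Finite := by
    refine ((w.sublists.toFinset.finite_toSet).image wexp).subset ?_
    rintro r ⟨x, -, hx, rfl⟩
    exact ⟨x, by simpa using hx.sublist, rfl⟩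
  constructor
  · intro h s p hp hs hcube
    set x := (w.drop s).take (3 * p) with hx
    have hlen : x.length = 3 * p := by simp [hx]; omega
    have hget : ∀ i, i < 3 * p → x.getD i false = w.getD (s + i) false := fun i hi => by
      simp [hx, List.getD_eq_getElem?_getD, hi]
    have hper : HasPeriodW x p := by
      refine ⟨hp, by omega, fun i hi => ?_⟩
      rw [hget i (by omega), hget (i + p) (by omega), ← add_assoc]
      exact hcube (s + i) (by omega) (by omega)
    have h1 : per x ≤ p := Nat.sInf_le hper
    have h2 : 1 ≤ per x := (Nat.sInf_mem (s := {p | HasPeriodW x p}) ⟨p, hper⟩).1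
    have h3 : 3 ≤ wexp x := by
      have : (1 : ℝ) ≤ per x := by exact_mod_cast h2
      have : (per x : ℝ) ≤ p := by exact_mod_cast h1
      rw [wexp, hlen, le_div_iff₀ (by linarith)]
      push_cast
      linarith
    have h4 : wexp x ∈ S := by
      refine ⟨x, fun h0 => ?_, (List.take_prefix _ _).isInfix.trans (List.drop_suffix _ _).isInfix,
        rfl⟩
      rw [h0] at hlen
      simp at hlen
      omega
    exact absurd (h3.trans (le_csSup hfin.bddAbove h4)) (not_le.mpr h)
  · intro h
    change sSup S < 3
    rcases S.eq_empty_or_nonempty with he | hne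
    · rw [he, Real.sSup_empty]; norm_num
    obtain ⟨x, hx0, ⟨u, v, huv⟩, hr⟩ := hne.csSup_mem hfin
    rw [hr]
    by_contra! hge
    have hpos : 0 < x.length := List.length_pos_iff.mpr hx0
    obtain ⟨h1, h2, h3⟩ := Nat.sInf_mem (s := {p | HasPeriodW x p})
      ⟨x.length, hpos, le_rfl, fun i hi => by omega⟩
    change 1 ≤ per x at h1
    change ∀ i, i + per x < _ → _ = x.getD (i + per x) false at h3
    have h4 : 3 * per x ≤ x.length := by
      have : (0 : ℝ) < per x := by exact_mod_cast h1
      rw [wexp, le_div_iff₀ this] at hge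
      exact_mod_cast hge
    have hlen : w.length = u.length + x.length + v.length := by rw [← huv]; simp; omega
    have hget : ∀ i, i < x.length → w.getD (u.length + i) false = x.getD i false := fun i hi => by
      rw [← huv]
      simp [List.getD_eq_getElem?_getD, List.getElem?_append, hi]
    refine h u.length (per x) h1 (by omega) fun i hi1 hi2 => ?_
    obtain ⟨j, rfl⟩ := Nat.exists_eq_add_of_le hi1
    change w.getD _ _ = w.getD _ _
    rw [add_assoc, hget j (by omega), hget _ (by omega), h3 j (by omega)]

/-- Letter `i` of the image of `W` under the clipped Thue–Morse morphism `f_{ℓ,k}`. -/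
def clippedImage (ℓ k : ℕ) (W : ℕ → Bool) (i : ℕ) : Bool := W (i / k) ^^ tm (ℓ + i % k)

theorem getD_applyMorph_tmFactor (ℓ k : ℕ) (hk : 0 < k) (w : List Bool) (i : ℕ)
    (hi : i < k * w.length) :
    (applyMorph (tmFactor ℓ k) (wcompl (tmFactor ℓ k)) w).getD i false =
      clippedImage ℓ k (fun j => w.getD j false) i := by
  induction w generalizing i with
  | nil => simp at hi
  | cons b w ih =>
    have hblock : ∀ x, x < k →
        (bif b then wcompl (tmFactor ℓ k) else tmFactor ℓ k)[x]? = some (b ^^ tm (ℓ + x)) :=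
      fun x hx => by
        cases b <;> simp [wcompl, tmFactor] <;> exact ⟨x, List.getElem?_range hx, rfl⟩
    have hlen : (bif b then wcompl (tmFactor ℓ k) else tmFactor ℓ k).length = k := by
      cases b <;> simp [wcompl, tmFactor]
    have hcons : applyMorph (tmFactor ℓ k) (wcompl (tmFactor ℓ k)) (b :: w) =
        (bif b then wcompl (tmFactor ℓ k) else tmFactor ℓ k) ++
          applyMorph (tmFactor ℓ k) (wcompl (tmFactor ℓ k)) w := by simp [applyMorph]
    rw [hcons]
    rcases lt_or_ge i k with h | h
    · rw [List.getD_append _ _ _ _ (by omega), List.getD_eq_getElem?_getD, hblock i h]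
      simp [clippedImage, Nat.div_eq_of_lt h, Nat.mod_eq_of_lt h]
    · rw [List.getD_append_right _ _ _ _ (by omega), hlen, ih (i - k) (by
        rw [List.length_cons, mul_add] at hi; omega)]
      obtain ⟨j, rfl⟩ := Nat.exists_eq_add_of_le h
      simp [clippedImage, Nat.add_div_left _ hk]

theorem length_applyMorph_tmFactor (ℓ k : ℕ) (w : List Bool) :
    (applyMorph (tmFactor ℓ k) (wcompl (tmFactor ℓ k)) w).length = k * w.length := by
  induction w with
  | nil => simp [applyMorph]
  | cons b w ih =>
    have : applyMorph (tmFactor ℓ k) (wcompl (tmFactor ℓ k)) (b :: w) =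
        (bif b then wcompl (tmFactor ℓ k) else tmFactor ℓ k) ++
          applyMorph (tmFactor ℓ k) (wcompl (tmFactor ℓ k)) w := by simp [applyMorph]
    rw [this, List.length_append, ih]
    cases b <;> simp [wcompl, tmFactor] <;> ring

theorem clippedImage_add (ℓ k : ℕ) (W : ℕ → Bool) {i x : ℕ} (h : i % k + x < k) :
    clippedImage ℓ k W (i + x) = (W (i / k) ^^ tm (ℓ + i % k + x)) := by
  have hdm := Nat.div_add_mod' i k
  have hdiv : (i + x) / k = i / k :=
    Nat.div_eq_of_lt_le (by omega) (by rw [add_mul]; omega)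
  have hmod : (i + x) % k = i % k + x := by
    have h1 := Nat.div_add_mod (i + x) k
    have h2 := Nat.div_add_mod i k
    rw [hdiv] at h1
    omega
  rw [clippedImage, hdiv, hmod, add_assoc]

theorem clippedImage_mul_add (ℓ k : ℕ) (W : ℕ → Bool) (j : ℕ) {x : ℕ} (h : x < k) :
    clippedImage ℓ k W (j * k + x) = (W j ^^ tm (ℓ + x)) := by
  have hk : 0 < k := by omega
  have := clippedImage_add ℓ k W (i := j * k) (x := x) (by simpa using h)
  simpa [Nat.mul_div_cancel _ hk] using this

/-- Two equal windows of length five inside blocks have offsets of the same parity. -/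
theorem offset_parity_of_window_eq {ℓ k : ℕ} {W : ℕ → Bool} {n p : ℕ} (h1 : n % k + 5 ≤ k)
    (h2 : (n + p) % k + 5 ≤ k)
    (h : ∀ i, n ≤ i → i ≤ n + 4 → clippedImage ℓ k W i = clippedImage ℓ k W (i + p)) :
    n % k % 2 = (n + p) % k % 2 := by
  obtain ⟨i, hi1, hi2, hi⟩ := exists_tm_eq_succ (ℓ + n % k)
  obtain ⟨x, rfl⟩ := Nat.exists_eq_add_of_le hi1
  have h3 : clippedImage ℓ k W (n + p + x) = clippedImage ℓ k W (n + p + x + 1) := by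
    rw [show n + p + x = n + x + p by ring, show n + x + p + 1 = n + (x + 1) + p by ring,
      ← h _ (by omega) (by omega), ← h _ (by omega) (by omega), clippedImage_add _ _ _ (by omega),
      clippedImage_add _ _ _ (by omega), hi, add_assoc]
  rw [add_assoc (n + p), clippedImage_add _ _ _ (by omega), clippedImage_add _ _ _ (by omega)] at h3
  have h4 := odd_of_tm_eq_succ (i := ℓ + (n + p) % k + x) (by simpa [add_assoc] using h3)
  have h5 := odd_of_tm_eq_succ hi
  omega

/-- A period shifting an odd block boundary, with its surrounding windows, stays close to block
boundaries. -/
theorem mod_near_zero_of_boundary {ℓ k : ℕ} {W : ℕ → Bool} (hodd : k % 2 = 1) (hk : 11 ≤ k)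
    {b p : ℕ} (hb : k ∣ b + 5) (h : ∀ i, b ≤ i → i < b + 10 →
      clippedImage ℓ k W i = clippedImage ℓ k W (i + p)) :
    (b + 5 + p) % k ≤ 4 ∨ k ≤ (b + 5 + p) % k + 4 := by
  by_contra! hcon
  have e1 : (b + 5) % k = 0 := Nat.mod_eq_zero_of_dvd hb
  have e2 : b % k = k - 5 := by
    obtain ⟨c, hc⟩ := hb
    obtain ⟨c, rfl⟩ : ∃ c', c = c' + 1 := ⟨c - 1, by
      rcases c with _ | c
      · omega
      · simp⟩
    rw [show b = k - 5 + k * c by rw [mul_add] at hc; omega, Nat.add_mul_mod_self_left,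
      Nat.mod_eq_of_lt (by omega)]
  have e3 : (b + p) % k = (b + 5 + p) % k - 5 := by
    have := Nat.div_add_mod (b + 5 + p) k
    rw [show b + p = (b + 5 + p) % k - 5 + k * ((b + 5 + p) / k) by omega,
      Nat.add_mul_mod_self_left, Nat.mod_eq_of_lt (by omega)]
  have h1 := offset_parity_of_window_eq (n := b) (p := p) (by omega) (by omega)
    fun i _ _ => h i (by omega) (by omega)
  have h2 := offset_parity_of_window_eq (n := b + 5) (p := p) (by omega) (by omega)
    fun i _ _ => h i (by omega) (by omega)
  omega

theorem not_periodic_of_mod_add_le {ℓ k : ℕ} {W : ℕ → Bool} {s p n : ℕ} (hp : 1 ≤ p)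
    (hn : 2 * p + 1 ≤ n) (hs : s % k + n ≤ k) :
    ¬ ∀ i, s ≤ i → i + p < s + n → clippedImage ℓ k W i = clippedImage ℓ k W (i + p) := by
  intro h
  refine tm_overlap_free p (ℓ + s % k) hp fun i hi1 hi2 => ?_
  obtain ⟨x, rfl⟩ := Nat.exists_eq_add_of_le hi1
  have := h (s + x) (by omega) (by omega)
  rw [add_assoc, clippedImage_add _ _ _ (by omega), clippedImage_add _ _ _ (by omega)] at this
  simpa [add_assoc] using this

theorem mod_near_zero_of_cubeAt {ℓ k : ℕ} {W : ℕ → Bool} (hodd : k % 2 = 1) (hk : 11 ≤ k)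
    {s p : ℕ} (hp : 9 ≤ p) (h : CubeAt (clippedImage ℓ k W) s p) :
    p % k ≤ 4 ∨ k ≤ p % k + 4 := by
  have hdm := Nat.div_add_mod (s + 4) k
  have hlt := Nat.mod_lt (s + 4) (show 0 < k by omega)
  set c := (s + 4) / k
  obtain ⟨b, hb⟩ : ∃ b, b + 5 = k * (c + 1) := ⟨k * (c + 1) - 5, by rw [mul_add]; omega⟩
  have hb' : b + 5 = k * c + k := by rw [hb]; ring
  rcases lt_or_ge (s + 3 * p) (b + 10) with h1 | h1
  · exact absurd (fun i h2 h3 => h i (by omega) (by omega))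
      (not_periodic_of_mod_add_le (ℓ := ℓ) (W := W) (k := k) (s := s + 4) (p := p) (n := 3 * p - 8)
        (by omega) (by omega) (by omega))
  rcases le_or_gt (b + 10) (s + 2 * p) with h2 | h2
  · have := mod_near_zero_of_boundary hodd hk (p := p) ⟨_, hb⟩
      fun i _ _ => h i (by omega) (by omega)
    rwa [hb, Nat.mul_add_mod] at this
  · by_contra! hcon
    obtain ⟨a, rfl⟩ := Nat.exists_eq_add_of_le (show p ≤ b by omega)
    have hdp := Nat.div_add_mod p k
    have e0 : (a + 5) % k = k - p % k := by
      have hc : p / k ≤ c := by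
        have : k * (p / k) < k * (c + 1) := by omega
        have := Nat.lt_of_mul_lt_mul_left this
        omega
      obtain ⟨d, hd⟩ := Nat.exists_eq_add_of_le hc
      rw [hd, mul_add] at hb'
      rw [show a + 5 = k - p % k + k * d by omega, Nat.add_mul_mod_self_left,
        Nat.mod_eq_of_lt (by omega)]
    have e1 : a % k = k - p % k - 5 := by
      have := Nat.div_add_mod (a + 5) k
      rw [show a = (a + 5) % k - 5 + k * ((a + 5) / k) by omega,
        Nat.add_mul_mod_self_left, Nat.mod_eq_of_lt (by omega), e0]
    have e2 : (a + 5 + p) % k = 0 := Nat.mod_eq_zero_of_dvd ⟨c + 1, by omega⟩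
    have e3 : (a + p) % k = k - 5 := by
      rw [show a + p = k - 5 + k * c by omega, Nat.add_mul_mod_self_left,
        Nat.mod_eq_of_lt (by omega)]
    have h3 := offset_parity_of_window_eq (ℓ := ℓ) (W := W) (n := a) (p := p) (by omega) (by omega)
      fun i _ _ => h i (by omega) (by omega)
    have h4 := offset_parity_of_window_eq (ℓ := ℓ) (W := W) (n := a + 5) (p := p) (by omega)
      (by omega) fun i _ _ => h i (by omega) (by omega)
    omega

/-- A cube whose period is a multiple of the block length comes from a cube of the preimage. -/
theorem cubeAt_of_cubeAt_mul {ℓ k : ℕ} {W : ℕ → Bool} (hk : 0 < k) {s q : ℕ}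
    (h : CubeAt (clippedImage ℓ k W) s (k * q)) : CubeAt W (s / k) q := by
  intro j hj1 hj2
  have hdm := Nat.div_add_mod s k
  have hlt := Nat.mod_lt s hk
  have h1 : k * j < s + 2 * (k * q) := by
    have : k * (j + 1) ≤ k * (s / k + 2 * q) := Nat.mul_le_mul_left _ hj2
    have e1 : k * (j + 1) = k * j + k := by ring
    have e2 : k * (s / k + 2 * q) = k * (s / k) + 2 * (k * q) := by ring
    omega
  obtain ⟨x, hx, hx1, hx2⟩ : ∃ x < k, s ≤ j * k + x ∧ j * k + x < s + 2 * (k * q) := by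
    rcases hj1.eq_or_lt with rfl | hj
    · refine ⟨s % k, hlt, ?_, ?_⟩ <;> rw [mul_comm (s / k)] <;> nlinarith
    · refine ⟨0, hk, ?_, by rw [mul_comm]; omega⟩
      have : k * (s / k + 1) ≤ k * j := Nat.mul_le_mul_left _ hj
      rw [mul_add] at this
      rw [mul_comm j]
      omega
  have := h _ hx1 hx2
  rw [show j * k + x + k * q = (j + q) * k + x by ring, clippedImage_mul_add _ _ _ _ hx,
    clippedImage_mul_add _ _ _ _ hx] at this
  simpa using this

/-- A period slightly off a multiple of the block length yields a short period, up to
complementation, of a long factor of the Thue–Morse word. -/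
theorem exists_tm_shift_of_cubeAt {ℓ k : ℕ} {W : ℕ → Bool} (hk : 11 ≤ k) {s p : ℕ} (hp : 9 ≤ p)
    (h : CubeAt (clippedImage ℓ k W) s p) (hmod : p % k ≠ 0)
    (hr : p % k ≤ 4 ∨ k ≤ p % k + 4) :
    ∃ r x₀ n e, 1 ≤ r ∧ r ≤ 4 ∧ k ≤ n + r + r / 2 ∧ (k ≤ p → x₀ = ℓ ∧ n + r = k) ∧
      (r = 4 → k = 11 → k ≤ p) ∧
      ∀ x, x₀ ≤ x → x < x₀ + n → tm (x + r) = (tm x ^^ e) := by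
  have hdp := Nat.div_add_mod p k
  have hlt := Nat.mod_lt p (show 0 < k by omega)
  have hds := Nat.div_add_mod s k
  have hls := Nat.mod_lt s (show 0 < k by omega)
  set q := p / k
  set j := s / k
  set d := p % k
  have hq : k ≤ p → 1 ≤ q := fun h => Nat.div_pos h (by omega)
  rcases hr with hr | hr
  · have hq1 : 1 ≤ q := by
      rcases Nat.eq_zero_or_pos q with h0 | h0
      · rw [h0] at hdp; omega
      · exact h0
    have hkq : k * 1 ≤ k * q := Nat.mul_le_mul_left _ hq1
    refine ⟨d, ℓ, k - d, W (j + 1) ^^ W (j + 1 + q), by omega, hr, by omega,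
      fun _ => ⟨rfl, by omega⟩, fun _ _ => by omega, fun x hx1 hx2 => ?_⟩
    obtain ⟨x, rfl⟩ := Nat.exists_eq_add_of_le hx1
    have e : (j + 1) * k = k * j + k := by ring
    have := h ((j + 1) * k + x) (by omega) (by omega)
    rw [show (j + 1) * k + x + p = (j + 1 + q) * k + (x + d) by rw [← hdp]; ring,
      clippedImage_mul_add _ _ _ _ (by omega), clippedImage_mul_add _ _ _ _ (by omega)] at this
    rw [add_assoc]
    revert this
    cases W (j + 1) <;> cases W (j + 1 + q) <;> simp <;> intro h <;> simp [h]
  · obtain ⟨r, hrd⟩ : ∃ r, d + r = k := ⟨k - d, by omega⟩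
    have key : ∀ j' x, x + r < k → s ≤ j' * k + (x + r) → j' * k + (x + r) < s + 2 * p →
        tm (ℓ + x + r) = (tm (ℓ + x) ^^ (W j' ^^ W (j' + q + 1))) := fun j' x hx h1 h2 => by
      have := h _ h1 h2
      rw [show j' * k + (x + r) + p = (j' + q + 1) * k + x by
          calc _ = j' * k + x + k * q + (d + r) := by rw [← hdp]; ring
            _ = _ := by rw [hrd]; ring,
        clippedImage_mul_add _ _ _ _ (by omega), clippedImage_mul_add _ _ _ _ (by omega)] at this
      rw [add_assoc]
      revert this
      cases W j' <;> cases W (j' + q + 1) <;> simp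
    have e : (j + 1) * k = k * j + k := by ring
    have e' : j * k = k * j := by ring
    rcases le_or_gt k p with hkp | hkp
    · refine ⟨r, ℓ, k - r, W (j + 1) ^^ W (j + 1 + q + 1), by omega, by omega, by omega,
        fun _ => ⟨rfl, by omega⟩, fun _ _ => hkp, fun x hx1 hx2 => ?_⟩
      obtain ⟨x, rfl⟩ := Nat.exists_eq_add_of_le hx1
      exact key _ _ (by omega) (by omega) (by omega)
    have hpd : p = d := (Nat.mod_eq_of_lt hkp).symm
    rcases le_or_gt (s % k) (r + r / 2) with ha | ha
    · refine ⟨r, ℓ + (s % k - r), k - max (s % k) r, W j ^^ W (j + q + 1), by omega, by omega,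
        by omega, by omega, by omega, fun x hx1 hx2 => ?_⟩
      obtain ⟨x, rfl⟩ := Nat.exists_eq_add_of_le ((Nat.le_add_right ℓ _).trans hx1)
      exact key _ _ (by omega) (by omega) (by omega)
    · refine ⟨r, ℓ, k - r - (2 * r - s % k), W (j + 1) ^^ W (j + 1 + q + 1), by omega, by omega,
        by omega, by omega, by omega, fun x hx1 hx2 => ?_⟩
      obtain ⟨x, rfl⟩ := Nat.exists_eq_add_of_le hx1
      exact key _ _ (by omega) (by omega) (by omega)

theorem lt_of_tm_shift {r x₀ n : ℕ} {e : Bool} (hr : 1 ≤ r)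
    (h : ∀ x, x₀ ≤ x → x < x₀ + n → tm (x + r) = (tm x ^^ e)) : n < 3 * r + 1 := by
  by_contra! hn
  refine tm_overlap_free (2 * r) x₀ (by omega) fun x h1 h2 => ?_
  rw [two_mul, ← add_assoc, h (x + r) (by omega) (by omega), h x h1 (by omega)]
  simp

theorem even_of_tm_shift {r x₀ n : ℕ} {e : Bool} (hn : 5 ≤ n)
    (h : ∀ x, x₀ ≤ x → x < x₀ + n → tm (x + r) = (tm x ^^ e)) : r % 2 = 0 := by
  obtain ⟨i, h1, h2, h3⟩ := exists_tm_eq_succ x₀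
  have h4 : tm (i + r) = tm (i + r + 1) := by
    rw [h i h1 (by omega), h3, ← h (i + 1) (by omega) (by omega), add_right_comm]
  have := odd_of_tm_eq_succ h3
  have := odd_of_tm_eq_succ h4
  omega

theorem not_cubeAt_of_nine_le {ℓ k : ℕ} {W : ℕ → Bool} (hodd : k % 2 = 1) (hk : 11 ≤ k)
    (hk8 : k % 8 = 3) (hℓ : k = 11 → ℓ = 6 ∨ ℓ = 7) {s p : ℕ} (hp : 9 ≤ p) (hmod : p % k ≠ 0) :
    ¬ CubeAt (clippedImage ℓ k W) s p := by
  intro h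
  obtain ⟨r, x₀, n, e, hr1, hr4, hn, hfull, h11, hshift⟩ :=
    exists_tm_shift_of_cubeAt hk hp h hmod (mod_near_zero_of_cubeAt hodd hk hp h)
  have h1 := lt_of_tm_shift hr1 hshift
  have h2 := even_of_tm_shift (by omega) hshift
  obtain ⟨rfl, rfl⟩ : r = 4 ∧ k = 11 := by omega
  obtain ⟨rfl, hn'⟩ := hfull (h11 rfl rfl)
  obtain rfl : n = 7 := by omega
  have h3 : ∀ y < 7, tm (x₀ + y + 4) = (tm (x₀ + y) ^^ e) := fun y hy =>
    hshift _ (by omega) (by omega)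
  rcases hℓ rfl with rfl | rfl <;> revert h3 <;> revert e <;> decide +kernel

theorem tm_block_add (j a y : ℕ) :
    tm (2 ^ j * a + y) = (tm (a + y / 2 ^ j) ^^ tm (y % 2 ^ j)) := by
  rw [← tm_two_pow_mul_add j _ _ (Nat.mod_lt _ (by positivity)), mul_add, add_assoc,
    Nat.div_add_mod]

/-- The 46 letters around a block boundary, as determined by five consecutive letters `c` of the
Thue–Morse word and by whether the two blocks differ. The clipping offset is `ℓ = k - 5 + δ`. -/
def boundaryWord (δ : ℕ) (c : List Bool) (e : Bool) (z : ℕ) : Bool :=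
  if z < 23 then c.getD ((10 + δ + z) / 16) false ^^ tm ((10 + δ + z) % 16)
  else e ^^ (c.getD ((δ + z - 17) / 8 + 1) false ^^ tm ((δ + z - 17) % 8))

theorem boundaryWord_not_cube (δ : ℕ) (c₀ c₁ c₂ c₃ c₄ e : Bool)
    (hδ : δ = 0 ∧ c₁ ≠ c₂ ∨ δ = 1 ∧ c₀ ≠ c₁ ∧ c₁ = c₂ ∧ c₂ ≠ c₃) :
    ∀ p < 9, 1 ≤ p → ∀ y < 3 * p, 1 ≤ y → ∃ i < 2 * p,
      boundaryWord δ [c₀, c₁, c₂, c₃, c₄] e (23 - y + i) ≠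
        boundaryWord δ [c₀, c₁, c₂, c₃, c₄] e (23 - y + i + p) := by
  rcases hδ with ⟨rfl, h⟩ | ⟨rfl, h⟩ <;> revert c₀ c₁ c₂ c₃ c₄ e <;> decide +kernel

theorem clippedImage_eq_boundaryWord {a δ : ℕ} {W : ℕ → Bool} {j z : ℕ} (ha : 1 ≤ a) (hz : z < 46)
    (hδ : δ ≤ 1) :
    clippedImage (8 * a + 14 + δ) (8 * a + 19) W (j * (8 * a + 19) + (8 * a + 19 - 23) + z) =
      (W j ^^ boundaryWord δ [tm a, tm (a + 1), tm (a + 2), tm (a + 3), tm (a + 4)]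
        (W j ^^ W (j + 1)) z) := by
  have hc : ∀ i < 5, [tm a, tm (a + 1), tm (a + 2), tm (a + 3), tm (a + 4)].getD i false =
      tm (a + i) := fun i hi => by interval_cases i <;> rfl
  unfold boundaryWord
  split_ifs with h
  · rw [add_assoc (j * _), clippedImage_mul_add _ _ _ _ (by omega), hc _ (by omega),
      show 8 * a + 14 + δ + (8 * a + 19 - 23 + z) = 2 ^ 4 * a + (10 + δ + z) by omega,
      tm_block_add]
    rfl
  · have e1 : (j + 1) * (8 * a + 19) = j * (8 * a + 19) + (8 * a + 19) := by ring
    rw [show j * (8 * a + 19) + (8 * a + 19 - 23) + z = (j + 1) * (8 * a + 19) + (z - 23) by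
        omega, clippedImage_mul_add _ _ _ _ (by omega), hc _ (by omega),
      show 8 * a + 14 + δ + (z - 23) = 2 ^ 3 * (a + 1) + (δ + z - 17) by omega,
      tm_block_add, show a + ((δ + z - 17) / 8 + 1) = a + 1 + (δ + z - 17) / 2 ^ 3 by omega]
    cases W j <;> simp

theorem not_cubeAt_of_lt_nine {a δ : ℕ} {W : ℕ → Bool} {s p : ℕ} (ha : 1 ≤ a)
    (hδ : δ = 0 ∧ tm (a + 1) ≠ tm (a + 2) ∨ δ = 1 ∧ tm (a + 1) = tm (a + 2))
    (hp : 1 ≤ p) (hp9 : p < 9) :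
    ¬ CubeAt (clippedImage (8 * a + 14 + δ) (8 * a + 19) W) s p := by
  intro h
  have hds := Nat.div_add_mod' s (8 * a + 19)
  have hls := Nat.mod_lt s (show 0 < 8 * a + 19 by omega)
  rcases le_or_gt (s % (8 * a + 19) + 3 * p) (8 * a + 19) with h1 | h1
  · exact not_periodic_of_mod_add_le hp (by omega) h1 fun i h2 h3 => h i h2 (by omega)
  have hδ' : δ = 0 ∧ tm (a + 1) ≠ tm (a + 2) ∨
      δ = 1 ∧ tm a ≠ tm (a + 1) ∧ tm (a + 1) = tm (a + 2) ∧ tm (a + 2) ≠ tm (a + 3) := by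
    refine hδ.imp_right fun ⟨h0, h1⟩ => ⟨h0, fun h2 => ?_, h1, fun h2 => ?_⟩
    all_goals
      have := odd_of_tm_eq_succ h1
      have := odd_of_tm_eq_succ h2
      omega
  obtain ⟨y, hy⟩ : ∃ y, s % (8 * a + 19) + y = 8 * a + 19 := ⟨_, Nat.add_sub_of_le hls.le⟩
  obtain ⟨i, hi, hne⟩ := boundaryWord_not_cube δ (tm a) (tm (a + 1)) (tm (a + 2)) (tm (a + 3))
    (tm (a + 4)) (W (s / (8 * a + 19)) ^^ W (s / (8 * a + 19) + 1)) hδ' p hp9 hp y (by omega)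
    (by omega)
  have key := fun z hz => clippedImage_eq_boundaryWord (W := W) (j := s / (8 * a + 19)) (z := z)
    ha hz (show δ ≤ 1 by omega)
  have h2 := h (s + i) (by omega) (by omega)
  rw [show s + i = s / (8 * a + 19) * (8 * a + 19) + (8 * a + 19 - 23) + (23 - y + i) by omega,
    key _ (by omega), add_assoc (_ + _) _ p, key _ (by omega)] at h2
  exact hne (by simpa [add_assoc] using h2)

theorem clippedImage_shift_eq (ℓ k : ℕ) (W : ℕ → Bool) (s : ℕ) {i : ℕ} (hi : s % k + i < 4 * k) :
    clippedImage ℓ k W (s + i) = clippedImage ℓ k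
      (fun j => [W (s / k), W (s / k + 1), W (s / k + 2), W (s / k + 3)].getD j false)
      (s % k + i) := by
  have hk : 0 < k := by omega
  have hlt : (s % k + i) / k < 4 := Nat.div_lt_of_lt_mul (by omega)
  have e : s + i = k * (s / k) + (s % k + i) := by rw [← add_assoc, Nat.div_add_mod]
  unfold clippedImage
  rw [e, Nat.mul_add_div hk, Nat.mul_add_mod]
  congr 1
  generalize (s % k + i) / k = j at hlt
  interval_cases j <;> rfl

theorem not_cubeAt_of_lt_nine_of_small {ℓ k : ℕ} (hℓk : ℓ = 6 ∧ k = 11 ∨ ℓ = 15 ∧ k = 19)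
    {W : ℕ → Bool} {s p : ℕ} (hp : 1 ≤ p) (hp9 : p < 9) : ¬ CubeAt (clippedImage ℓ k W) s p := by
  intro h
  have hfin : ∀ w₀ w₁ w₂ w₃ : Bool, ∀ a < k, ∀ p < 9, 1 ≤ p → ∃ i < 2 * p,
      clippedImage ℓ k (fun j => [w₀, w₁, w₂, w₃].getD j false) (a + i) ≠
        clippedImage ℓ k (fun j => [w₀, w₁, w₂, w₃].getD j false) (a + (i + p)) := by
    rcases hℓk with ⟨rfl, rfl⟩ | ⟨rfl, rfl⟩ <;> decide +kernel
  have hls := Nat.mod_lt s (show 0 < k by omega)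
  obtain ⟨i, hi, hne⟩ := hfin (W (s / k)) (W (s / k + 1)) (W (s / k + 2)) (W (s / k + 3)) _ hls
    p hp9 hp
  rw [← clippedImage_shift_eq ℓ k W s (i := i) (by omega),
    ← clippedImage_shift_eq ℓ k W s (i := i + p) (by omega), ← add_assoc] at hne
  exact hne (h _ (by omega) (by omega))

theorem cubefreeC_of_not_cubeAt {ℓ k : ℕ} (hk : 0 < k)
    (h : ∀ W s p, 1 ≤ p → p % k ≠ 0 → ¬ CubeAt (clippedImage ℓ k W) s p) :
    CubefreeC (tmFactor ℓ k) := by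
  intro w hw
  rw [ce_lt_three_iff] at hw ⊢
  intro s p hp hs hcube
  rw [length_applyMorph_tmFactor] at hs
  have hcube' : CubeAt (clippedImage ℓ k fun j => w.getD j false) s p := fun i h1 h2 => by
    rw [← getD_applyMorph_tmFactor ℓ k hk w i (by omega),
      ← getD_applyMorph_tmFactor ℓ k hk w (i + p) (by omega)]
    exact hcube i h1 h2
  by_cases hmod : p % k = 0
  · obtain ⟨q, rfl⟩ := Nat.dvd_of_mod_eq_zero hmod
    refine hw _ q (Nat.pos_of_mul_pos_left hp) ?_ (cubeAt_of_cubeAt_mul hk hcube')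
    have := Nat.mul_div_le s k
    exact Nat.le_of_mul_le_mul_left (by linarith) hk
  · exact h _ s p hp hmod hcube'

theorem cubefreeC_of_choice {m δ : ℕ} (hm : 1 ≤ m)
    (hδ : δ = 0 ∧ tm (m - 1) ≠ tm m ∨ δ = 1 ∧ tm (m - 1) = tm m) :
    CubefreeC (tmFactor (8 * m - 2 + δ) (8 * m + 3)) := by
  refine cubefreeC_of_not_cubeAt (by omega) fun W s p hp hmod => ?_
  rcases le_or_gt 9 p with hp9 | hp9
  · exact not_cubeAt_of_nine_le (by omega) (by omega) (by omega) (by omega) hp9 hmod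
  rcases le_or_gt m 2 with hm2 | hm2
  · refine not_cubeAt_of_lt_nine_of_small ?_ hp hp9
    interval_cases m
    · rcases hδ with ⟨rfl, -⟩ | ⟨-, h⟩
      · simp
      · exact absurd h (by decide +kernel)
    · rcases hδ with ⟨-, h⟩ | ⟨rfl, -⟩
      · exact absurd h (by decide +kernel)
      · simp
  · obtain ⟨a, rfl⟩ := Nat.exists_eq_add_of_le hm2.le
    have := not_cubeAt_of_lt_nine (a := a) (δ := δ) (W := W) (s := s) (p := p) (by omega)
      (by rwa [show 2 + a - 1 = a + 1 by omega, add_comm 2 a] at hδ) hp hp9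
    rwa [show 8 * a + 14 + δ = 8 * (2 + a) - 2 + δ by omega,
      show 8 * a + 19 = 8 * (2 + a) + 3 by omega] at this

/-- for odd `k` with `k ≡ 3 (mod 8)` and `k ≥ 11`, at least one
of the clipped Thue–Morse morphisms `f_{k-5,k}` and `f_{k-4,k}` is cubefree. -/
theorem stmt11 (k : ℕ) (hodd : Odd k) (hk8 : k % 8 = 3) (hk : 11 ≤ k) :
    CubefreeC (tmFactor (k - 5) k) ∨ CubefreeC (tmFactor (k - 4) k) := by
  obtain ⟨m, rfl⟩ : ∃ m, k = 8 * m + 3 := ⟨k / 8, by omega⟩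
  by_cases h : tm (m - 1) = tm m
  · right
    rw [show 8 * m + 3 - 4 = 8 * m - 2 + 1 by omega]
    exact cubefreeC_of_choice (by omega) (Or.inr ⟨rfl, h⟩)
  · left
    rw [show 8 * m + 3 - 5 = 8 * m - 2 + 0 by omega]
    exact cubefreeC_of_choice (by omega) (Or.inl ⟨rfl, h⟩)
end

section
/- Let v be a finite factor of the Thue–Morse word t having, for some letter a ∈ {0,1} with complement ā, the word a a or the word a ā a ā as a prefix or as a suffix. Then the clipped Thue–Morse morphism f_v is not cubefree: there exists a finite binary word w with ce(w) < 3 such that ce(f_v(w)) ≥ 3. -/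
/-- The smallest period of a nonempty word is a period. -/
theorem hasPeriodW_per {x : List Bool} (hx : x ≠ []) : HasPeriodW x (per x) :=
  Nat.sInf_mem (s := {p | HasPeriodW x p})
    ⟨x.length, List.length_pos_of_ne_nil hx, le_rfl, fun _ hi => absurd hi (by omega)⟩

theorem wexp_le_length {x : List Bool} (hx : x ≠ []) : wexp x ≤ x.length :=
  div_le_self (Nat.cast_nonneg _) (by exact_mod_cast (hasPeriodW_per hx).1)

theorem ce_le_length (w : List Bool) : ce w ≤ w.length := by
  refine Real.sSup_le ?_ (Nat.cast_nonneg _)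
  rintro r ⟨x, hx, hxw, rfl⟩
  exact (wexp_le_length hx).trans (by exact_mod_cast hxw.length_le)

theorem wexp_le_ce {x w : List Bool} (hx : x ≠ []) (hxw : x <:+: w) : wexp x ≤ ce w := by
  refine le_csSup ⟨w.length, ?_⟩ ⟨x, hx, hxw, rfl⟩
  rintro r ⟨y, hy, hyw, rfl⟩
  exact (wexp_le_length hy).trans (by exact_mod_cast hyw.length_le)

/-- A word containing a cube has critical exponent at least `3`. -/
theorem three_le_ce_of_cube {x w : List Bool} (hx : x ≠ []) (hxw : x ++ x ++ x <:+: w) :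
    3 ≤ ce w := by
  have hpos := List.length_pos_of_ne_nil hx
  have hne : x ++ x ++ x ≠ [] := by simp [hx]
  have hper : HasPeriodW (x ++ x ++ x) x.length := by
    refine ⟨hpos, by simp, fun i hi => ?_⟩
    simp only [List.length_append] at hi
    rw [List.getD_append _ _ _ _ (by simp; omega), List.append_assoc,
      List.getD_append_right x (x ++ x) _ _ (by omega), Nat.add_sub_cancel]
  have hle : per (x ++ x ++ x) ≤ x.length := Nat.sInf_le hper
  refine le_trans ?_ (wexp_le_ce hne hxw)
  have h1 : (0 : ℝ) < per (x ++ x ++ x) := by exact_mod_cast (hasPeriodW_per hne).1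
  rw [wexp, le_div_iff₀ h1]
  have h2 : (per (x ++ x ++ x) : ℝ) ≤ x.length := by exact_mod_cast hle
  simp only [List.length_append, Nat.cast_add]
  linarith

/-- A cube straddling the images of two letters shows that the complementary morphism of `v` is
not cubefree. -/
theorem exists_of_cube {v x s p : List Bool} (b c : Bool) (hx : x ≠ []) (hsp : s ++ p = x ++ x ++ x)
    (hs : s <:+ bif b then wcompl v else v) (hp : p <+: bif c then wcompl v else v) :
    ∃ w : List Bool, ce w < 3 ∧ (3 : ℝ) ≤ ce (applyMorph v (wcompl v) w) := by
  refine ⟨[b, c], lt_of_le_of_lt (ce_le_length _) (by norm_num), three_le_ce_of_cube hx ?_⟩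
  obtain ⟨l, hl⟩ := hs
  obtain ⟨r, hr⟩ := hp
  refine ⟨l, r, ?_⟩
  simp only [applyMorph, List.map_cons, List.map_nil, List.flatten_cons, List.flatten_nil,
    List.append_nil, ← hl, ← hr, ← hsp, List.append_assoc]

theorem wcompl_suffix {s v : List Bool} (h : s <:+ v) : wcompl s <:+ wcompl v := h.map _

theorem wcompl_prefix {s v : List Bool} (h : s <+: v) : wcompl s <+: wcompl v := h.map _

/-- A suffix `s` of `v` or of its complement is a suffix of the image of some letter. -/
theorem exists_image_suffix {s u v : List Bool} (h : u <:+ v) (hs : s = u ∨ s = wcompl u) :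
    ∃ b : Bool, s <:+ bif b then wcompl v else v := by
  rcases hs with rfl | rfl
  exacts [⟨false, h⟩, ⟨true, wcompl_suffix h⟩]

/-- A prefix `p` of `v` or of its complement is a prefix of the image of some letter. -/
theorem exists_image_prefix {p u v : List Bool} (h : u <+: v) (hp : p = u ∨ p = wcompl u) :
    ∃ b : Bool, p <+: bif b then wcompl v else v := by
  rcases hp with rfl | rfl
  exacts [⟨false, h⟩, ⟨true, wcompl_prefix h⟩]

theorem exists_pair_prefix {v : List Bool} (h : 2 ≤ v.length) : ∃ d e, [d, e] <+: v := by
  match v, h with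
  | d :: e :: r, _ => exact ⟨d, e, r, rfl⟩

theorem exists_pair_suffix {v : List Bool} (h : 2 ≤ v.length) : ∃ d e, [d, e] <:+ v := by
  obtain ⟨d, e, hde⟩ := exists_pair_prefix (v := v.reverse) (by simpa using h)
  exact ⟨e, d, by simpa using List.reverse_suffix.2 hde⟩

theorem exists_of_square_prefix {v : List Bool} {a : Bool} (h : [a, a] <+: v) :
    ∃ w : List Bool, ce w < 3 ∧ (3 : ℝ) ≤ ce (applyMorph v (wcompl v) w) := by
  obtain ⟨d, e, hde⟩ := exists_pair_suffix h.length_le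
  have he : [e] <:+ v := (List.suffix_cons d [e]).trans hde
  obtain ⟨b, hb⟩ := exists_image_suffix (s := [a]) he (by cases a <;> cases e <;> simp [wcompl])
  exact exists_of_cube (x := [a]) b false (by simp) (List.append_assoc _ _ _).symm hb h

theorem exists_of_square_suffix {v : List Bool} {a : Bool} (h : [a, a] <:+ v) :
    ∃ w : List Bool, ce w < 3 ∧ (3 : ℝ) ≤ ce (applyMorph v (wcompl v) w) := by
  obtain ⟨d, e, hde⟩ := exists_pair_prefix h.length_le
  have hd : [d] <+: v := (List.prefix_append [d] [e]).trans hde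
  obtain ⟨b, hb⟩ := exists_image_prefix (p := [a]) hd (by cases a <;> cases d <;> simp [wcompl])
  exact exists_of_cube (x := [a]) false b (by simp) rfl h hb

theorem exists_of_alternating_prefix {v : List Bool} {a : Bool} (h : [a, !a, a, !a] <+: v) :
    ∃ w : List Bool, ce w < 3 ∧ (3 : ℝ) ≤ ce (applyMorph v (wcompl v) w) := by
  obtain ⟨d, e, hde⟩ := exists_pair_suffix (le_trans (by simp) h.length_le)
  by_cases hd : d = e
  · exact exists_of_square_suffix (hd ▸ hde)
  obtain ⟨b, hb⟩ := exists_image_suffix (s := [a, !a]) hde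
    (by revert hd; cases a <;> cases d <;> cases e <;> simp [wcompl])
  exact exists_of_cube (x := [a, !a]) b false (by simp) (List.append_assoc _ _ _).symm hb h

theorem exists_of_alternating_suffix {v : List Bool} {a : Bool} (h : [a, !a, a, !a] <:+ v) :
    ∃ w : List Bool, ce w < 3 ∧ (3 : ℝ) ≤ ce (applyMorph v (wcompl v) w) := by
  obtain ⟨d, e, hde⟩ := exists_pair_prefix (le_trans (by simp) h.length_le)
  by_cases hd : d = e
  · exact exists_of_square_prefix (hd ▸ hde)
  obtain ⟨b, hb⟩ := exists_image_prefix (p := [a, !a]) hde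
    (by revert hd; cases a <;> cases d <;> cases e <;> simp [wcompl])
  exact exists_of_cube (x := [a, !a]) false b (by simp) rfl h hb

/-- if `v` is a factor of the Thue–Morse word having, for some
letter `a`, the word `a a` or `a ā a ā` as a prefix or a suffix, then the
clipped Thue–Morse morphism `f_v` is not cubefree. -/
theorem stmt15 (v : List Bool) (hv : IsTMFactor v)
    (hcond : ∃ a : Bool,
      ([a, a] <+: v) ∨ ([a, a] <:+ v) ∨
      ([a, !a, a, !a] <+: v) ∨ ([a, !a, a, !a] <:+ v)) :
    ∃ w : List Bool, ce w < 3 ∧ (3 : ℝ) ≤ ce (applyMorph v (wcompl v) w) := by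
  obtain ⟨a, h | h | h | h⟩ := hcond
  exacts [exists_of_square_prefix h, exists_of_square_suffix h,
    exists_of_alternating_prefix h, exists_of_alternating_suffix h]
end
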